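/- Let p be a prime and 0 ≤ i ≤ m integers. Let ξ⁽ⁱ⁾ = I₄ + pⁱ·e₄₂ ∈ GL₄(ℤ_p), K_p^m ⊆ GL₄(ℤ_p) the mirahoric subgroup of level m (bottom row ≡ (0,0,0,1) mod p^m), and P the (2,2)-parabolic with Levi projection κ. Then κ(P(ℚ_p) ∩ ξ⁽ⁱ⁾ K_p^m (ξ⁽ⁱ⁾)⁻¹) = K_p(m−i) × K_p(i), where K_p(j) ⊆ GL₂(ℤ_p) is the subgroup of matrices with bottom row ≡ (0,1) mod p^j. -/

import Mathlib

open Matrix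

/-- The `(2,2)`-parabolic `P(ℚ_p) ⊆ GL₄(ℚ_p)`. -/
def parabolicP (p : ℕ) [Fact p.Prime] : Set (Matrix (Fin 4) (Fin 4) ℚ_[p]) :=
  {g | IsUnit g.det ∧ g 2 0 = 0 ∧ g 2 1 = 0 ∧ g 3 0 = 0 ∧ g 3 1 = 0}

/-- The mirahoric subgroup `K_p^m ⊆ GL₄(ℤ_p)` of level `m`. -/
def mirahoric (p : ℕ) [Fact p.Prime] (m : ℕ) : Set (Matrix (Fin 4) (Fin 4) ℚ_[p]) :=
  {g | (∀ i j, ‖g i j‖ ≤ 1) ∧ ‖g.det‖ = 1 ∧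
    ‖g 3 0‖ ≤ (p : ℝ) ^ (-(m : ℤ)) ∧ ‖g 3 1‖ ≤ (p : ℝ) ^ (-(m : ℤ)) ∧
    ‖g 3 2‖ ≤ (p : ℝ) ^ (-(m : ℤ)) ∧ ‖g 3 3 - 1‖ ≤ (p : ℝ) ^ (-(m : ℤ))}

/-- Upper-left `2×2` block. -/
def ulBlock (p : ℕ) [Fact p.Prime] (g : Matrix (Fin 4) (Fin 4) ℚ_[p]) :
    Matrix (Fin 2) (Fin 2) ℚ_[p] :=
  fun i j => g ⟨i.1, by omega⟩ ⟨j.1, by omega⟩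

/-- Lower-right `2×2` block. -/
def lrBlock (p : ℕ) [Fact p.Prime] (g : Matrix (Fin 4) (Fin 4) ℚ_[p]) :
    Matrix (Fin 2) (Fin 2) ℚ_[p] :=
  fun i j => g ⟨i.1 + 2, by omega⟩ ⟨j.1 + 2, by omega⟩

/-- `K_p(j) ⊆ GL₂(ℤ_p)`: bottom row congruent to `(0,1)` mod `p^j`. -/
def mirahoric2 (p : ℕ) [Fact p.Prime] (j : ℕ) : Set (Matrix (Fin 2) (Fin 2) ℚ_[p]) :=
  {g | (∀ i j, ‖g i j‖ ≤ 1) ∧ ‖g.det‖ = 1 ∧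
    ‖g 1 0‖ ≤ (p : ℝ) ^ (-(j : ℤ)) ∧ ‖g 1 1 - 1‖ ≤ (p : ℝ) ^ (-(j : ℤ))}

/-- `ξ⁽ⁱ⁾ = I₄ + pⁱ e₄₂`. -/
noncomputable def xiRep (p : ℕ) [Fact p.Prime] (i : ℕ) : Matrix (Fin 4) (Fin 4) ℚ_[p] :=
  !![1, 0, 0, 0; 0, 1, 0, 0; 0, 0, 1, 0; 0, (p : ℚ_[p]) ^ i, 0, 1]

lemma padic_norm_add_le {p : ℕ} [Fact p.Prime] {x y : ℚ_[p]} {r : ℝ} (hx : ‖x‖ ≤ r)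
    (hy : ‖y‖ ≤ r) : ‖x + y‖ ≤ r :=
  (Padic.nonarchimedean x y).trans (max_le hx hy)

lemma padic_norm_sub_le {p : ℕ} [Fact p.Prime] {x y : ℚ_[p]} {r : ℝ} (hx : ‖x‖ ≤ r)
    (hy : ‖y‖ ≤ r) : ‖x - y‖ ≤ r := by
  rw [sub_eq_add_neg]
  exact padic_norm_add_le hx (by rwa [norm_neg])

lemma padic_norm_pow_mul_le_iff {p : ℕ} [Fact p.Prime] {i m : ℕ} (him : i ≤ m) (x : ℚ_[p]) :
    ‖(p : ℚ_[p]) ^ i * x‖ ≤ (p : ℝ) ^ (-(m : ℤ)) ↔ ‖x‖ ≤ (p : ℝ) ^ (-((m - i : ℕ) : ℤ)) := by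
  have hp : (0 : ℝ) < p := by exact_mod_cast (Fact.out : p.Prime).pos
  have h : (p : ℝ) ^ (-(m : ℤ)) = (p : ℝ) ^ (-(i : ℤ)) * (p : ℝ) ^ (-((m - i : ℕ) : ℤ)) := by
    rw [← zpow_add₀ hp.ne']
    congr 1
    omega
  rw [norm_mul, Padic.norm_p_pow, h]
  exact mul_le_mul_iff_right₀ (zpow_pos hp _)

lemma padic_norm_pow_mul_le {p : ℕ} [Fact p.Prime] {i : ℕ} {x : ℚ_[p]} (hx : ‖x‖ ≤ 1) :
    ‖(p : ℚ_[p]) ^ i * x‖ ≤ (p : ℝ) ^ (-(i : ℤ)) :=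
  (padic_norm_pow_mul_le_iff le_rfl x).2 (by simpa using hx)

lemma prime_zpow_neg_le_one {p : ℕ} [Fact p.Prime] (i : ℕ) : (p : ℝ) ^ (-(i : ℤ)) ≤ 1 :=
  zpow_le_one_of_nonpos₀ (by exact_mod_cast (Fact.out : p.Prime).one_le) (by omega)

lemma padic_norm_det_fin_two_le {p : ℕ} [Fact p.Prime] {A : Matrix (Fin 2) (Fin 2) ℚ_[p]}
    (hA : ∀ r c, ‖A r c‖ ≤ 1) : ‖A.det‖ ≤ 1 := by
  rw [det_fin_two]
  refine padic_norm_sub_le ?_ ?_ <;> rw [norm_mul] <;>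
    exact mul_le_one₀ (hA _ _) (norm_nonneg _) (hA _ _)

lemma det_eq_ulBlock_mul_lrBlock {p : ℕ} [Fact p.Prime] {g : Matrix (Fin 4) (Fin 4) ℚ_[p]}
    (h20 : g 2 0 = 0) (h21 : g 2 1 = 0) (h30 : g 3 0 = 0) (h31 : g 3 1 = 0) :
    g.det = (ulBlock p g).det * (lrBlock p g).det := by
  let e : Fin 2 ⊕ Fin 2 ≃ Fin 4 := finSumFinEquiv
  have hg : g.submatrix e e =
      fromBlocks (ulBlock p g) (g.submatrix e e).toBlocks₁₂ 0 (lrBlock p g) := by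
    ext r c
    rcases r with r | r <;> rcases c with c | c <;> fin_cases r <;> fin_cases c <;>
      first | rfl | exact h20 | exact h21 | exact h30 | exact h31
  rw [← det_submatrix_equiv_self e g, hg, det_fromBlocks_zero₂₁]

lemma det_xiRep (p : ℕ) [Fact p.Prime] (i : ℕ) : (xiRep p i).det = 1 := by
  simp [xiRep, det_succ_row_zero, Fin.sum_univ_succ, Fin.succAbove]

lemma xiRep_inv (p : ℕ) [Fact p.Prime] (i : ℕ) : (xiRep p i)⁻¹ =
    !![1, 0, 0, 0; 0, 1, 0, 0; 0, 0, 1, 0; 0, -(p : ℚ_[p]) ^ i, 0, 1] := by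
  refine inv_eq_right_inv ?_
  ext r c
  fin_cases r <;> fin_cases c <;> simp [xiRep, mul_apply, Fin.sum_univ_four]

lemma det_xiRep_conj {p : ℕ} [Fact p.Prime] (i : ℕ) (k : Matrix (Fin 4) (Fin 4) ℚ_[p]) :
    (xiRep p i * k * (xiRep p i)⁻¹).det = k.det := by
  rw [det_mul, det_mul, det_nonsing_inv, det_xiRep]
  simp

lemma xiRep_conj {p : ℕ} [Fact p.Prime] (i : ℕ) (k : Matrix (Fin 4) (Fin 4) ℚ_[p]) :
    xiRep p i * k * (xiRep p i)⁻¹ =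
      let q := (p : ℚ_[p]) ^ i
      !![k 0 0, k 0 1 - q * k 0 3, k 0 2, k 0 3;
        k 1 0, k 1 1 - q * k 1 3, k 1 2, k 1 3;
        k 2 0, k 2 1 - q * k 2 3, k 2 2, k 2 3;
        k 3 0 + q * k 1 0, k 3 1 + q * k 1 1 - q * (k 3 3 + q * k 1 3), k 3 2 + q * k 1 2,
          k 3 3 + q * k 1 3] := by
  rw [xiRep_inv]
  ext r c
  fin_cases r <;> fin_cases c <;> simp [xiRep, mul_apply, vecMul, dotProduct, Fin.sum_univ_four] <;> ring

/-- The Levi projection of an element of `P(ℚ_p)` conjugate by `ξ⁽ⁱ⁾` to an element of `K_p^m`. -/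
lemma levi_blocks_mem {p : ℕ} [Fact p.Prime] {i m : ℕ} (him : i ≤ m)
    {k : Matrix (Fin 4) (Fin 4) ℚ_[p]} (hk : k ∈ mirahoric p m)
    (hP : xiRep p i * k * (xiRep p i)⁻¹ ∈ parabolicP p) :
    ulBlock p (xiRep p i * k * (xiRep p i)⁻¹) ∈ mirahoric2 p (m - i) ∧
      lrBlock p (xiRep p i * k * (xiRep p i)⁻¹) ∈ mirahoric2 p i := by
  obtain ⟨hint, hdet, h30, h31, h32, h33⟩ := hk
  obtain ⟨-, g20, g21, g30, g31⟩ := hP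
  have hq : ∀ {x : ℚ_[p]}, ‖x‖ ≤ 1 → ‖(p : ℚ_[p]) ^ i * x‖ ≤ 1 := fun hx =>
    (padic_norm_pow_mul_le hx).trans (prime_zpow_neg_le_one i)
  have hmi : (p : ℝ) ^ (-(m : ℤ)) ≤ (p : ℝ) ^ (-(i : ℤ)) :=
    zpow_le_zpow_right₀ (by exact_mod_cast (Fact.out : p.Prime).one_le) (by omega)
  have hul : ∀ r c, ‖ulBlock p (xiRep p i * k * (xiRep p i)⁻¹) r c‖ ≤ 1 := by
    rw [xiRep_conj]
    intro r c
    fin_cases r <;> fin_cases c <;>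
      first
      | exact hint _ _
      | exact padic_norm_sub_le (hint _ _) (hq (hint _ _))
  have hlr : ∀ r c, ‖lrBlock p (xiRep p i * k * (xiRep p i)⁻¹) r c‖ ≤ 1 := by
    rw [xiRep_conj]
    intro r c
    fin_cases r <;> fin_cases c <;>
      first
      | exact hint _ _
      | exact padic_norm_add_le (hint _ _) (hq (hint _ _))
  have hprod : ‖(ulBlock p (xiRep p i * k * (xiRep p i)⁻¹)).det‖ *
      ‖(lrBlock p (xiRep p i * k * (xiRep p i)⁻¹)).det‖ = 1 := by
    rw [← norm_mul, ← det_eq_ulBlock_mul_lrBlock g20 g21 g30 g31, det_xiRep_conj, hdet]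
  have hul_det := padic_norm_det_fin_two_le hul
  have hlr_det := padic_norm_det_fin_two_le hlr
  refine ⟨⟨hul, ?_, ?_, ?_⟩, hlr, ?_, ?_, ?_⟩
  · nlinarith [norm_nonneg (ulBlock p (xiRep p i * k * (xiRep p i)⁻¹)).det]
  · rw [xiRep_conj] at g30 ⊢
    change k 3 0 + (p : ℚ_[p]) ^ i * k 1 0 = 0 at g30
    change ‖k 1 0‖ ≤ _
    rw [← padic_norm_pow_mul_le_iff him, eq_neg_of_add_eq_zero_right g30, norm_neg]
    exact h30
  · rw [xiRep_conj] at g31 ⊢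
    change k 3 1 + (p : ℚ_[p]) ^ i * k 1 1 -
      (p : ℚ_[p]) ^ i * (k 3 3 + (p : ℚ_[p]) ^ i * k 1 3) = 0 at g31
    change ‖k 1 1 - (p : ℚ_[p]) ^ i * k 1 3 - 1‖ ≤ _
    have h : (p : ℚ_[p]) ^ i * (k 1 1 - (p : ℚ_[p]) ^ i * k 1 3 - 1) =
        (p : ℚ_[p]) ^ i * (k 3 3 - 1) - k 3 1 := by linear_combination g31
    rw [← padic_norm_pow_mul_le_iff him, h]
    refine padic_norm_sub_le ?_ h31
    rw [padic_norm_pow_mul_le_iff him]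
    exact h33.trans
      (zpow_le_zpow_right₀ (by exact_mod_cast (Fact.out : p.Prime).one_le) (by omega))
  · nlinarith [norm_nonneg (lrBlock p (xiRep p i * k * (xiRep p i)⁻¹)).det]
  · rw [xiRep_conj]
    exact padic_norm_add_le (h32.trans hmi) (padic_norm_pow_mul_le (hint _ _))
  · rw [xiRep_conj]
    change ‖k 3 3 + (p : ℚ_[p]) ^ i * k 1 3 - 1‖ ≤ _
    rw [add_sub_right_comm]
    exact padic_norm_add_le (h33.trans hmi) (padic_norm_pow_mul_le (hint _ _))

/-- Every pair in `K_p(m-i) × K_p(i)` lifts to `P(ℚ_p) ∩ ξ⁽ⁱ⁾ K_p^m (ξ⁽ⁱ⁾)⁻¹`. -/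
lemma exists_levi_lift {p : ℕ} [Fact p.Prime] {i m : ℕ} (him : i ≤ m)
    {A D : Matrix (Fin 2) (Fin 2) ℚ_[p]} (hA : A ∈ mirahoric2 p (m - i))
    (hD : D ∈ mirahoric2 p i) :
    ∃ k ∈ mirahoric p m, xiRep p i * k * (xiRep p i)⁻¹ ∈ parabolicP p ∧
      ulBlock p (xiRep p i * k * (xiRep p i)⁻¹) = A ∧
      lrBlock p (xiRep p i * k * (xiRep p i)⁻¹) = D := by
  obtain ⟨hA, hAdet, hA10, hA11⟩ := hA
  obtain ⟨hD, hDdet, hD10, hD11⟩ := hD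
  have hq0 : (p : ℚ_[p]) ^ i ≠ 0 :=
    pow_ne_zero _ (by exact_mod_cast (Fact.out : p.Prime).ne_zero)
  have hdiv : ∀ {x : ℚ_[p]}, ‖x‖ ≤ (p : ℝ) ^ (-(i : ℤ)) →
      ∃ y : ℚ_[p], ‖y‖ ≤ 1 ∧ x = (p : ℚ_[p]) ^ i * y := by
    intro x hx
    refine ⟨x / (p : ℚ_[p]) ^ i, ?_, by field_simp⟩
    simpa using (padic_norm_pow_mul_le_iff le_rfl (x / (p : ℚ_[p]) ^ i)).1
      (by rwa [mul_div_cancel₀ x hq0])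
  obtain ⟨b, hb, hDb⟩ := hdiv hD10
  obtain ⟨c, hc, hDc⟩ := hdiv hD11
  set q := (p : ℚ_[p]) ^ i with hqdef
  have hq : ∀ {x : ℚ_[p]}, ‖x‖ ≤ 1 → ‖q * x‖ ≤ 1 := fun hx =>
    (padic_norm_pow_mul_le hx).trans (prime_zpow_neg_le_one i)
  let k : Matrix (Fin 4) (Fin 4) ℚ_[p] :=
    !![A 0 0, A 0 1, 0, 0;
      A 1 0, A 1 1 + q * c, b, c;
      0, q * D 0 1, D 0 0, D 0 1;
      -(q * A 1 0), -(q * (A 1 1 - 1)), 0, 1]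
  have hconj : xiRep p i * k * (xiRep p i)⁻¹ =
      !![A 0 0, A 0 1, 0, 0; A 1 0, A 1 1, b, c; 0, 0, D 0 0, D 0 1; 0, 0, D 1 0, D 1 1] := by
    rw [xiRep_conj, hDb, eq_add_of_sub_eq hDc]
    ext r c
    fin_cases r <;> fin_cases c <;> simp [k, ← hqdef] <;> ring
  have hul : ulBlock p (xiRep p i * k * (xiRep p i)⁻¹) = A := by
    rw [hconj]
    ext r c
    fin_cases r <;> fin_cases c <;> rfl
  have hlr : lrBlock p (xiRep p i * k * (xiRep p i)⁻¹) = D := by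
    rw [hconj]
    ext r c
    fin_cases r <;> fin_cases c <;> rfl
  have hdet : ‖(xiRep p i * k * (xiRep p i)⁻¹).det‖ = 1 := by
    rw [det_eq_ulBlock_mul_lrBlock, hul, hlr, norm_mul, hAdet, hDdet, one_mul] <;>
      rw [hconj] <;> rfl
  have hk30 : ‖k 3 0‖ ≤ (p : ℝ) ^ (-(m : ℤ)) := by
    change ‖-(q * A 1 0)‖ ≤ _
    rwa [norm_neg, padic_norm_pow_mul_le_iff him]
  have hk31 : ‖k 3 1‖ ≤ (p : ℝ) ^ (-(m : ℤ)) := by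
    change ‖-(q * (A 1 1 - 1))‖ ≤ _
    rwa [norm_neg, padic_norm_pow_mul_le_iff him]
  refine ⟨k, ⟨?_, by rwa [det_xiRep_conj] at hdet, hk30, hk31, ?_, ?_⟩, ⟨?_, ?_⟩, hul, hlr⟩
  · exact fun
      | 0, 0 => hA 0 0
      | 0, 1 => hA 0 1
      | 0, 2 => norm_zero.trans_le zero_le_one
      | 0, 3 => norm_zero.trans_le zero_le_one
      | 1, 0 => hA 1 0
      | 1, 1 => padic_norm_add_le (hA 1 1) (hq hc)
      | 1, 2 => hb
      | 1, 3 => hc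
      | 2, 0 => norm_zero.trans_le zero_le_one
      | 2, 1 => hq (hD 0 1)
      | 2, 2 => hD 0 0
      | 2, 3 => hD 0 1
      | 3, 0 => hk30.trans (prime_zpow_neg_le_one m)
      | 3, 1 => hk31.trans (prime_zpow_neg_le_one m)
      | 3, 2 => norm_zero.trans_le zero_le_one
      | 3, 3 => norm_one.le
  · change ‖(0 : ℚ_[p])‖ ≤ _
    rw [norm_zero]
    positivity
  · change ‖(1 : ℚ_[p]) - 1‖ ≤ _
    rw [sub_self, norm_zero]
    positivity
  · rw [isUnit_iff_ne_zero, ← norm_ne_zero_iff, hdet]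
    exact one_ne_zero
  · rw [hconj]
    exact ⟨rfl, rfl, rfl, rfl⟩

/-- for `0 ≤ i ≤ m`, the Levi projection of
`P(ℚ_p) ∩ ξ⁽ⁱ⁾ K_p^m (ξ⁽ⁱ⁾)⁻¹` equals `K_p(m−i) × K_p(i)`. -/
theorem levi_projection_xi (p : ℕ) [Fact p.Prime] (i m : ℕ) (him : i ≤ m) :
    (fun g => (ulBlock p g, lrBlock p g)) ''
        (parabolicP p ∩
          {g | ∃ k ∈ mirahoric p m, g = xiRep p i * k * (xiRep p i)⁻¹}) =
      (mirahoric2 p (m - i)) ×ˢ (mirahoric2 p i) := by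
  ext ⟨A, D⟩
  constructor
  · rintro ⟨_, ⟨hP, k, hk, rfl⟩, h⟩
    rw [← h]
    exact levi_blocks_mem him hk hP
  · rintro ⟨hA, hD⟩
    obtain ⟨k, hk, hP, rfl, rfl⟩ := exists_levi_lift him hA hD
    exact ⟨_, ⟨hP, k, hk, rfl⟩, rfl⟩
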